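/- Let Γ be a simple polygon, F a finite set of guards covering the boundary of Γ but not all of Γ, and R₀ a connected component of the hidden region. Then the closure of R₀ has at least three boundary segments, and hence there are at least three distinct support lines of R₀. -/

import Mathlib

open Set

noncomputable section

/-- Points of the Euclidean plane. -/
abbrev Pt : Type := EuclideanSpace ℝ (Fin 2)

/-- A simple polygon: a compact region of the plane bounded by a simple closed
polygonal curve.  Vertices are indexed by `ℤ`, periodically with period `n`. -/
structure SimplePolygon where
  carrier : Set Pt
  n : ℕ
  three_le : 3 ≤ n
  vertex : ℤ → Pt
  periodic : ∀ i : ℤ, vertex (i + n) = vertex i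
  vertex_inj : ∀ i j : ℤ, 0 ≤ i → i < n → 0 ≤ j → j < n → vertex i = vertex j → i = j
  compact : IsCompact carrier
  connected : IsConnected carrier
  regular : carrier = closure (interior carrier)
  boundary_eq : frontier carrier = ⋃ i : ℤ, segment ℝ (vertex i) (vertex (i + 1))
  adj_edges : ∀ i j : ℤ, (n : ℤ) ∣ (j - (i + 1)) → ¬ (n : ℤ) ∣ (j - i) →
    segment ℝ (vertex i) (vertex (i + 1)) ∩ segment ℝ (vertex j) (vertex (j + 1)) = {vertex j}
  nonadj_edges : ∀ i j : ℤ, ¬ (n : ℤ) ∣ (j - i) → ¬ (n : ℤ) ∣ (j - (i + 1)) →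
    ¬ (n : ℤ) ∣ (i - (j + 1)) →
    Disjoint (segment ℝ (vertex i) (vertex (i + 1))) (segment ℝ (vertex j) (vertex (j + 1)))

/-- `A`, `B` span a (maximal) boundary segment of the set `R`. -/
def IsBoundarySegment (R : Set Pt) (A B : Pt) : Prop :=
  A ≠ B ∧ segment ℝ A B ⊆ frontier R ∧
  ∀ A' B' : Pt, segment ℝ A B ⊆ segment ℝ A' B' → segment ℝ A' B' ⊆ frontier R →
    segment ℝ A' B' = segment ℝ A B

/-- `ℓ` is a support line of `R`: a line containing a boundary segment of the closure of `R`. -/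
def IsSupportLine (R : Set Pt) (ℓ : AffineSubspace ℝ Pt) : Prop :=
  ∃ A B : Pt, IsBoundarySegment (closure R) A B ∧ ℓ = affineSpan ℝ ({A, B} : Set Pt)

/-- Two regions are adjacent when they share a common boundary edge
(a nondegenerate segment). -/
def AdjacentRegions (R R' : Set Pt) : Prop :=
  R ≠ R' ∧ ∃ C D : Pt, C ≠ D ∧ segment ℝ C D ⊆ closure R ∩ closure R'

namespace SimplePolygon

variable (Γ : SimplePolygon)

/-- `G` sees `A`: the segment `GA` is contained in the polygon. -/
def Sees (G A : Pt) : Prop := segment ℝ G A ⊆ Γ.carrier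

/-- The guard set `F` (visually) covers the set `S`. -/
def Covers (F S : Set Pt) : Prop := ∀ A ∈ S, ∃ G ∈ F, Γ.Sees G A

/-- The view of a point `P`: all points of the polygon seen by `P`. -/
def View (P : Pt) : Set Pt := {A | A ∈ Γ.carrier ∧ Γ.Sees P A}

/-- The hidden region of a guard configuration `F`: points of the polygon seen by no guard. -/
def Hidden (F : Set Pt) : Set Pt := {A | A ∈ Γ.carrier ∧ ∀ G ∈ F, ¬ Γ.Sees G A}

/-- The polygon is normal: every configuration of guards covering the walls covers everything. -/
def Normal : Prop :=
  ∀ F : Set Pt, F ⊆ Γ.carrier → Γ.Covers F (frontier Γ.carrier) → Γ.Covers F Γ.carrier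

/-- The polygon is normal with respect to `A`: every configuration of guards inside `A`
covering the walls covers everything. -/
def NormalWrt (A : Set Pt) : Prop :=
  ∀ F : Set Pt, F ⊆ A → Γ.Covers F (frontier Γ.carrier) → Γ.Covers F Γ.carrier

/-- The corner at `vertex i` is reflex (interior angle exceeding 180°): points slightly
displaced from the vertex in the direction bisecting the (undirected) corner angle lie
outside the polygon. -/
def IsReflexCorner (i : ℤ) : Prop :=
  ∃ δ > (0 : ℝ), ∀ ε : ℝ, 0 < ε → ε < δ →
    Γ.vertex i + ε • ((Γ.vertex (i - 1) - Γ.vertex i) + (Γ.vertex (i + 1) - Γ.vertex i)) ∉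
      Γ.carrier

/-- The set of (indices in one period of) reflex corners of the polygon. -/
def reflexCorners : Set ℤ := {i : ℤ | 0 ≤ i ∧ i < Γ.n ∧ Γ.IsReflexCorner i}

/-- `(P, i)` is a feasible pair: `vertex i` is a reflex corner visible from `P` and the two
walls at the corner lie (weakly) on the same side of the line through `P` and `vertex i`. -/
def IsFeasible (P : Pt) (i : ℤ) : Prop :=
  Γ.IsReflexCorner i ∧ P ≠ Γ.vertex i ∧ Γ.Sees P (Γ.vertex i) ∧
  ∃ f : Pt →ₗ[ℝ] ℝ, f ≠ 0 ∧ f (Γ.vertex i - P) = 0 ∧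
    0 ≤ f (Γ.vertex (i - 1) - P) ∧ 0 ≤ f (Γ.vertex (i + 1) - P)

/-- `w` is a window of `P`: the segment from a reflex corner `C = vertex i` of a feasible
pair `(P, i)` to the farthest boundary point visible from `P` on the ray `P C` beyond `C`. -/
def IsWindow (P : Pt) (w : Set Pt) : Prop :=
  ∃ i : ℤ, ∃ W : Pt, Γ.IsFeasible P i ∧
    (∃ t : ℝ, 0 ≤ t ∧ W = Γ.vertex i + t • (Γ.vertex i - P)) ∧
    W ∈ frontier Γ.carrier ∧ Γ.Sees P W ∧
    (∀ W' : Pt, (∃ t : ℝ, 0 ≤ t ∧ W' = Γ.vertex i + t • (Γ.vertex i - P)) →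
      W' ∈ frontier Γ.carrier → Γ.Sees P W' → dist P W' ≤ dist P W) ∧
    w = segment ℝ (Γ.vertex i) W

/-- The union of all windows of points of `A`. -/
def windows (A : Set Pt) : Set Pt := ⋃₀ {w : Set Pt | ∃ P ∈ A, Γ.IsWindow P w}

/-- The (interiors of the) visibility regions of the visibility decomposition of the polygon
with respect to `A`: connected components of the interior of the polygon with all windows
removed. -/
def regionInteriors (A : Set Pt) : Set (Set Pt) :=
  {R : Set Pt | ∃ x ∈ interior Γ.carrier \ Γ.windows A,
    R = connectedComponentIn (interior Γ.carrier \ Γ.windows A) x}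

/-- `P` sees every point of `R`. -/
def SeesAll (P : Pt) (R : Set Pt) : Prop := ∀ x ∈ R, Γ.Sees P x

/-- `V(R)`: the set of points of `A` that see the (interior of the) region `R`. -/
def Vset (A R : Set Pt) : Set Pt := {P ∈ A | Γ.SeesAll P R}

/-- `R` is a sink of the visibility decomposition with respect to `A`. -/
def IsSink (A R : Set Pt) : Prop :=
  R ∈ Γ.regionInteriors A ∧
  ∀ R' ∈ Γ.regionInteriors A, AdjacentRegions R R' → Γ.Vset A R ⊆ Γ.Vset A R'

end SimplePolygon

/-- planar cross product -/
def cr (a b : Pt) : ℝ := a 0 * b 1 - a 1 * b 0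

theorem cr_add (a b c : Pt) : cr a (b + c) = cr a b + cr a c := by
  simp [cr]; ring
theorem cr_sub (a b c : Pt) : cr a (b - c) = cr a b - cr a c := by
  simp [cr]; ring
theorem cr_smul (a b : Pt) (t : ℝ) : cr a (t • b) = t * cr a b := by
  simp [cr]; ring
theorem cr_smul_left (a b : Pt) (t : ℝ) : cr (t • a) b = t * cr a b := by
  simp [cr]; ring
theorem cr_self (a : Pt) : cr a a = 0 := by
  simp [cr]; ring
theorem cr_cont (a : Pt) : Continuous (cr a) := by
  unfold cr; fun_prop

theorem cr_seg {a b p : Pt} (h : p ∈ segment ℝ a b) : cr (b - a) (p - a) = 0 := by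
  rw [segment_eq_image'] at h
  obtain ⟨t, -, rfl⟩ := h
  simp [cr]; ring

theorem cr_span {a b p : Pt} (h : p ∈ affineSpan ℝ ({a, b} : Set Pt)) :
    cr (b - a) (p - a) = 0 := by
  rw [_root_.mem_affineSpan_pair_iff_exists_lineMap_eq] at h
  obtain ⟨r, rfl⟩ := h
  simp [AffineMap.lineMap_apply, cr]; ring

/-- rotation by a right angle -/
def rot (u : Pt) : Pt := !₂[-(u 1), u 0]

theorem cr_rot_pos {u : Pt} (hu : u ≠ 0) : 0 < cr u (rot u) := by
  have h : cr u (rot u) = u 0 ^ 2 + u 1 ^ 2 := by simp [cr, rot]; ring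
  rw [h]
  by_contra hc
  apply hu
  have h0 : u 0 = 0 := by nlinarith [sq_nonneg (u 0), sq_nonneg (u 1)]
  have h1 : u 1 = 0 := by nlinarith [sq_nonneg (u 0), sq_nonneg (u 1)]
  ext i; fin_cases i <;> simp [h0, h1]

theorem cr_zero_of {u d : Pt} (hu : u ≠ 0) (h1 : cr d u = 0) (h2 : cr d (rot u) = 0) : d = 0 := by
  have hp := cr_rot_pos hu
  simp [cr, rot] at h1 h2 hp
  have e0 : d 0 * (u 0 * u 0 + u 1 * u 1) = 0 := by linear_combination u 0 * h2 + u 1 * h1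
  have e1 : d 1 * (u 0 * u 0 + u 1 * u 1) = 0 := by linear_combination u 1 * h2 - u 0 * h1
  have hne : u 0 * u 0 + u 1 * u 1 ≠ 0 := by linarith
  have h0 := (mul_eq_zero.1 e0).resolve_right hne
  have h1 := (mul_eq_zero.1 e1).resolve_right hne
  ext i; fin_cases i <;> simp [h0, h1]

/-- a preconnected set missing the frontier and meeting `C` lies in `C`. -/
theorem pre_sub {s C : Set Pt} (hs : IsPreconnected s) (hd : ∀ z ∈ s, z ∉ frontier C)
    {z : Pt} (hz : z ∈ s) (hzC : z ∈ C) : s ⊆ C := by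
  intro q hq
  by_contra hqC
  have key : ∀ w ∈ s, w ∈ closure C → w ∈ interior C := by
    intro w hw hwC
    by_contra hwi
    exact hd w hw ⟨hwC, hwi⟩
  obtain ⟨w, -, hw1, hw2⟩ := hs (interior C) (closure C)ᶜ isOpen_interior
    isClosed_closure.isOpen_compl (fun w hw => by
      by_cases h : w ∈ closure C
      · exact Or.inl (key w hw h)
      · exact Or.inr h)
    ⟨z, hz, key z hz (subset_closure hzC)⟩
    ⟨q, hq, fun h => hqC (interior_subset (key q hq h))⟩
  exact hw2 (subset_closure (interior_subset hw1))

theorem span_seg (A B : Pt) : affineSpan ℝ (segment ℝ A B) = affineSpan ℝ ({A, B} : Set Pt) := by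
  rw [← convexHull_pair, affineSpan_convexHull]

theorem extend_seg {K : Set Pt} (hK : IsCompact K) {A B : Pt} (hAB : A ≠ B)
    (h : segment ℝ A B ⊆ frontier K) :
    ∃ A' B' : Pt, IsBoundarySegment K A' B' ∧
      affineSpan ℝ ({A', B'} : Set Pt) = affineSpan ℝ ({A, B} : Set Pt) := by
  have hfc : IsCompact (frontier K) := hK.of_isClosed_subset isClosed_frontier
    hK.isClosed.frontier_subset
  set g : ℝ →ᵃ[ℝ] Pt := AffineMap.lineMap A B with hg
  have hgc : Continuous g := AffineMap.lineMap_continuous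
  have hcl : Topology.IsClosedEmbedding g := by
    have h1 := isClosedEmbedding_smul_left (𝕜 := ℝ) (sub_ne_zero.2 hAB.symm)
    have h2 := (Homeomorph.addRight A).isClosedEmbedding.comp h1
    convert h2 using 1
    funext t
    simp [hg, AffineMap.lineMap_apply]
  have hginj : Function.Injective g := hcl.injective
  set T : Set ℝ := g ⁻¹' frontier K with hT
  have hTc : IsCompact T := hcl.isCompact_preimage hfc
  have himg : ∀ a b : ℝ, segment ℝ (g a) (g b) = g '' segment ℝ a b := fun a b =>
    (image_segment ℝ g a b).symm
  have h01 : segment ℝ (0:ℝ) 1 ⊆ T := by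
    rw [hT, ← image_subset_iff, ← himg]; simpa [hg] using h
  have h0T : (0:ℝ) ∈ T := h01 (left_mem_segment ℝ 0 1)
  set C := connectedComponentIn T 0 with hC
  have hCT : C ⊆ T := connectedComponentIn_subset _ _
  have h01C : segment ℝ (0:ℝ) 1 ⊆ C :=
    (convex_segment (0:ℝ) 1).isPreconnected.subset_connectedComponentIn
      (left_mem_segment ℝ 0 1) h01
  have hCcl : IsClosed C := by
    have h1 : closure C ⊆ C := by
      refine IsPreconnected.subset_connectedComponentIn
        isPreconnected_connectedComponentIn.closure
        (subset_closure (h01C (left_mem_segment ℝ 0 1))) ?_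
      exact closure_minimal hCT hTc.isClosed
    exact closure_subset_iff_isClosed.1 h1
  have hCc : IsCompact C := hTc.of_isClosed_subset hCcl hCT
  have hCconn : IsConnected C := isConnected_connectedComponentIn_iff.2 h0T
  obtain hIcc := eq_Icc_of_connected_compact hCconn hCc
  set a := sInf C
  set b := sSup C
  have h0C : (0:ℝ) ∈ Icc a b := hIcc ▸ h01C (left_mem_segment ℝ 0 1)
  have h1C : (1:ℝ) ∈ Icc a b := hIcc ▸ h01C (right_mem_segment ℝ 0 1)
  have hab : a < b := by have := h0C.1; have := h1C.2; linarith
  have hsegab : segment ℝ a b = C := by rw [segment_eq_Icc hab.le, hIcc]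
  have hne : g a ≠ g b := fun e => hab.ne (hginj e)
  have hspan : affineSpan ℝ ({g a, g b} : Set Pt) = affineSpan ℝ ({A, B} : Set Pt) := by
    apply le_antisymm
    · exact affineSpan_pair_le_of_mem_of_mem (AffineMap.lineMap_mem_affineSpan_pair _ _ _)
        (AffineMap.lineMap_mem_affineSpan_pair _ _ _)
    · rw [← span_seg (g a) (g b)]
      apply affineSpan_pair_le_of_mem_of_mem
      · apply subset_affineSpan
        rw [himg, hsegab]
        exact ⟨0, h01C (left_mem_segment ℝ 0 1), by simp [hg]⟩
      · apply subset_affineSpan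
        rw [himg, hsegab]
        exact ⟨1, h01C (right_mem_segment ℝ 0 1), by simp [hg]⟩
  refine ⟨g a, g b, ⟨hne, ?_, ?_⟩, hspan⟩
  · rw [himg, hsegab, image_subset_iff]; exact hCT
  · intro A' B' hsub hfr
    refine Subset.antisymm ?_ hsub
    have hpre : IsPreconnected (g ⁻¹' segment ℝ A' B') := by
      exact ((convex_segment A' B').affine_preimage g).isPreconnected
    have hin : g ⁻¹' segment ℝ A' B' ⊆ C := by
      refine hpre.subset_connectedComponentIn ?_ (preimage_mono hfr)
      apply hsub
      rw [himg, hsegab]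
      exact ⟨0, h01C (left_mem_segment ℝ 0 1), rfl⟩
    intro p hp
    have : p ∈ range g := by
      have hA : A ∈ segment ℝ A' B' := hsub (by
        rw [himg, hsegab]
        exact ⟨0, h01C (left_mem_segment ℝ 0 1), by simp [hg]⟩)
      have hB : B ∈ segment ℝ A' B' := hsub (by
        rw [himg, hsegab]
        exact ⟨1, h01C (right_mem_segment ℝ 0 1), by simp [hg]⟩)
      rw [segment_eq_image'] at hA hB hp
      obtain ⟨α, -, hα⟩ := hA
      obtain ⟨β, -, hβ⟩ := hB
      obtain ⟨γ, -, hγ⟩ := hp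
      simp only at hα hβ hγ
      have hαβ : β - α ≠ 0 := by
        intro e
        apply hAB
        rw [← hα, ← hβ, sub_eq_zero.1 e]
      refine ⟨(γ - α) / (β - α), ?_⟩
      have e1 : B - A = (β - α) • (B' - A') := by rw [← hα, ← hβ]; module
      rw [hg, AffineMap.lineMap_apply, vsub_eq_sub, e1, smul_smul, div_mul_cancel₀ _ hαβ,
        ← hγ, ← hα, vadd_eq_add]
      module
    obtain ⟨t, rfl⟩ := this
    rw [himg, hsegab]
    exact ⟨t, hin hp, rfl⟩


/-- the three-segment engine -/
theorem find_seg {K : Set Pt} (hK : IsCompact K) (hKi : (interior K).Nonempty)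
    {S : Set (Pt × Pt)} (hS : S.Countable) (hSne : ∀ l ∈ S, l.1 ≠ l.2)
    (hcov : ∀ y ∈ frontier K, ∃ l ∈ S, cr (l.2 - l.1) (y - l.1) = 0)
    (P₁ Q₁ P₂ Q₂ : Pt) (h1 : P₁ ≠ Q₁) (h2 : P₂ ≠ Q₂) :
    ∃ A B : Pt, A ≠ B ∧ segment ℝ A B ⊆ frontier K ∧
      cr (Q₁ - P₁) (A - P₁) ≠ 0 ∧ cr (Q₂ - P₂) (A - P₂) ≠ 0 := by
  -- off-line point
  have off : ∀ (P Q : Pt), P ≠ Q → ∀ U : Set Pt, IsOpen U → U.Nonempty →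
      ∃ c ∈ U, cr (Q - P) (c - P) ≠ 0 := by
    intro P Q hPQ U hU ⟨c, hc⟩
    by_contra hcon
    push Not at hcon
    have hpos := cr_rot_pos (sub_ne_zero.2 hPQ.symm)
    have hcont : Filter.Tendsto (fun t : ℝ => c + t • rot (Q - P)) (nhdsWithin 0 {0}ᶜ) (nhds c) := by
      have : Continuous (fun t : ℝ => c + t • rot (Q - P)) := by fun_prop
      have h := this.tendsto 0
      simp only [zero_smul, add_zero] at h
      exact h.mono_left nhdsWithin_le_nhds
    obtain ⟨t, ht, ht0⟩ := ((hcont.eventually (hU.mem_nhds hc)).and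
      self_mem_nhdsWithin).exists
    have e1 := hcon _ ht
    have e2 := hcon c hc
    rw [show c + t • rot (Q - P) - P = (c - P) + t • rot (Q - P) by abel, cr_add, cr_smul, e2,
      zero_add] at e1
    rcases mul_eq_zero.1 e1 with h | h
    · exact ht0 h
    · exact hpos.ne' h
  obtain ⟨c₁, hc₁, hcc₁⟩ := off P₁ Q₁ h1 _ isOpen_interior hKi
  have hO : IsOpen {c : Pt | cr (Q₁ - P₁) (c - P₁) ≠ 0} :=
    isOpen_ne.preimage ((cr_cont _).comp (continuous_id.sub continuous_const))
  obtain ⟨c, ⟨hcK, hcL₁⟩, hcL₂⟩ := off P₂ Q₂ h2 _ (isOpen_interior.inter hO) ⟨c₁, hc₁, hcc₁⟩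
  simp only [mem_ofPred_eq] at hcL₁
  -- direction
  obtain ⟨u, hu0, hu1, hu2⟩ : ∃ u : Pt, u ≠ 0 ∧ cr (Q₁ - P₁) u = 0 ∧
      0 ≤ cr (Q₂ - P₂) u * cr (Q₂ - P₂) (c - P₂) := by
    rcases le_total 0 (cr (Q₂ - P₂) (Q₁ - P₁) * cr (Q₂ - P₂) (c - P₂)) with h | h
    · exact ⟨Q₁ - P₁, sub_ne_zero.2 h1.symm, cr_self _, h⟩
    · refine ⟨(-1 : ℝ) • (Q₁ - P₁), ?_, ?_, ?_⟩
      · simpa using sub_ne_zero.2 h1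
      · rw [cr_smul, cr_self, mul_zero]
      · rw [cr_smul]; nlinarith
  set w := rot u with hw
  have huw : 0 < cr u w := cr_rot_pos hu0
  have hray : ∀ t : ℝ, 0 ≤ t → cr (Q₁ - P₁) (c + t • u - P₁) ≠ 0 ∧
      cr (Q₂ - P₂) (c + t • u - P₂) ≠ 0 := by
    intro t ht
    constructor
    · rw [show c + t • u - P₁ = (c - P₁) + t • u by abel, cr_add, cr_smul, hu1]
      simpa using hcL₁
    · rw [show c + t • u - P₂ = (c - P₂) + t • u by abel, cr_add, cr_smul]
      intro h
      have h3 : 0 < cr (Q₂ - P₂) (c - P₂) ^ 2 := by positivity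
      have h4 := mul_nonneg ht hu2
      have h5 := congrArg (· * cr (Q₂ - P₂) (c - P₂)) h
      simp only [zero_mul] at h5
      nlinarith
  -- bound
  obtain ⟨T, hT0, hTK⟩ : ∃ T : ℝ, 0 ≤ T ∧ ∀ p ∈ Metric.ball c 1, p + T • u ∉ K := by
    obtain ⟨M, hM⟩ := hK.isBounded.subset_closedBall c
    have hun : 0 < ‖u‖ := norm_pos_iff.2 hu0
    refine ⟨(|M| + 1) / ‖u‖, by positivity, fun p hp hpK => ?_⟩
    have h3 := hM hpK
    rw [mem_closedBall_iff_norm] at h3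
    rw [mem_ball_iff_norm] at hp
    have h4 : ‖((|M| + 1) / ‖u‖) • u‖ = |M| + 1 := by
      rw [norm_smul, Real.norm_of_nonneg (by positivity), div_mul_cancel₀ _ hun.ne']
    have h5 : ((|M| + 1) / ‖u‖) • u = (p + ((|M| + 1) / ‖u‖) • u - c) - (p - c) := by abel
    have h6 := norm_sub_le (p + ((|M| + 1) / ‖u‖) • u - c) (p - c)
    rw [← h5, h4] at h6
    have hlt : ‖p - c‖ + M < |M| + 1 := by have := le_abs_self M; linarith
    linarith
  have hcontw : Continuous (fun s : ℝ => c + s • w) := by fun_prop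
  have htend : Filter.Tendsto (fun s : ℝ => c + s • w) (nhds 0) (nhds c) := by
    have h := hcontw.tendsto 0
    simpa using h
  have ev1 : ∀ᶠ s : ℝ in nhds 0, c + s • w ∈ interior K :=
    htend.eventually (isOpen_interior.mem_nhds hcK)
  have ev2 : ∀ᶠ s : ℝ in nhds 0, c + s • w ∈ Metric.ball c 1 :=
    htend.eventually (Metric.ball_mem_nhds c one_pos)
  have ev3 : ∀ᶠ s : ℝ in nhds 0, ∀ t ∈ Icc (0:ℝ) T,
      cr (Q₁ - P₁) (c + s • w + t • u - P₁) ≠ 0 ∧ cr (Q₂ - P₂) (c + s • w + t • u - P₂) ≠ 0 := by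
    apply isCompact_Icc.eventually_forall_of_forall_eventually
    intro t ht
    have hc1 : Continuous (fun z : ℝ × ℝ => cr (Q₁ - P₁) (c + z.1 • w + z.2 • u - P₁)) :=
      (cr_cont _).comp (by fun_prop)
    have hc2 : Continuous (fun z : ℝ × ℝ => cr (Q₂ - P₂) (c + z.1 • w + z.2 • u - P₂)) :=
      (cr_cont _).comp (by fun_prop)
    refine ((isOpen_ne.preimage hc1).inter (isOpen_ne.preimage hc2)).mem_nhds ?_
    have := hray t ht.1
    simpa using this
  obtain ⟨δ', hδ', hev⟩ := Metric.eventually_nhds_iff.1 (ev1.and (ev2.and ev3))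
  set δ := δ' / 2 with hδdef
  have hδ : 0 < δ := by positivity
  have hin : ∀ s ∈ Icc (-δ) δ, c + s • w ∈ interior K ∧ c + s • w ∈ Metric.ball c 1 ∧
      ∀ t ∈ Icc (0:ℝ) T, cr (Q₁ - P₁) (c + s • w + t • u - P₁) ≠ 0 ∧
        cr (Q₂ - P₂) (c + s • w + t • u - P₂) ≠ 0 := by
    intro s hs
    apply hev
    rw [Real.dist_eq, sub_zero]
    have := abs_le.2 hs
    linarith
  have hhit : ∀ s ∈ Icc (-δ) δ, ∃ t ∈ Icc (0:ℝ) T, c + s • w + t • u ∈ frontier K := by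
    intro s hs
    by_contra hcon
    push Not at hcon
    obtain ⟨g1, g2, -⟩ := hin s hs
    have hpre : IsPreconnected ((fun t : ℝ => c + s • w + t • u) '' Icc 0 T) :=
      isPreconnected_Icc.image _ (by fun_prop)
    have hsub := pre_sub (C := K) hpre (by rintro _ ⟨t, ht, rfl⟩; exact hcon t ht)
      ⟨0, ⟨le_rfl, hT0⟩, rfl⟩ (by simpa using interior_subset g1)
    exact hTK _ g2 (hsub ⟨T, ⟨hT0, le_rfl⟩, rfl⟩)
  -- Baire
  let B : S → Set ℝ := fun l => Prod.fst '' {z : ℝ × ℝ | z ∈ Icc (-δ) δ ×ˢ Icc 0 T ∧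
    c + z.1 • w + z.2 • u ∈ frontier K ∧
    cr (l.1.2 - l.1.1) (c + z.1 • w + z.2 • u - l.1.1) = 0}
  have hBcl : ∀ l, IsClosed (B l) := by
    intro l
    refine IsCompact.isClosed (IsCompact.image ?_ continuous_fst)
    refine (isCompact_Icc.prod isCompact_Icc).inter_right (IsClosed.inter ?_ ?_)
    · exact isClosed_frontier.preimage (f := fun z : ℝ × ℝ => c + z.1 • w + z.2 • u)
        (by fun_prop)
    · exact isClosed_singleton.preimage (t := {(0:ℝ)})
        (f := fun z : ℝ × ℝ => cr (l.1.2 - l.1.1) (c + z.1 • w + z.2 • u - l.1.1))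
        ((cr_cont _).comp (by fun_prop))
  have : Countable S := hS.to_subtype
  let f : Option S → Set ℝ := fun o => o.elim (Ioo (-δ) δ)ᶜ B
  have hfcl : ∀ o, IsClosed (f o) := by
    rintro (_ | l)
    · exact isOpen_Ioo.isClosed_compl
    · exact hBcl l
  have hfU : ⋃ o, f o = univ := by
    rw [eq_univ_iff_forall]
    intro s
    by_cases hs : s ∈ Ioo (-δ) δ
    · obtain ⟨t, ht, hfr⟩ := hhit s (Ioo_subset_Icc_self hs)
      obtain ⟨l, hl, hcr⟩ := hcov _ hfr
      exact mem_iUnion.2 ⟨some ⟨l, hl⟩, (s, t), ⟨⟨Ioo_subset_Icc_self hs, ht⟩, hfr, hcr⟩, rfl⟩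
    · exact mem_iUnion.2 ⟨none, hs⟩
  obtain ⟨s₀, hs₀, hs₀'⟩ := (dense_iUnion_interior_of_closed hfcl hfU).exists_mem_open
    (isOpen_Ioo (a := -δ) (b := δ)) ⟨0, by linarith, by linarith⟩
  obtain ⟨o, ho⟩ := mem_iUnion.1 hs₀
  obtain ⟨l, rfl⟩ : ∃ l, o = some l := by
    rcases o with _ | l
    · exact absurd hs₀' (interior_subset ho)
    · exact ⟨l, rfl⟩
  obtain ⟨ρ, hρ, hball⟩ := Metric.isOpen_iff.1 isOpen_interior s₀ ho
  have hBin : ∀ s ∈ Icc s₀ (s₀ + ρ / 2), s ∈ B l := by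
    intro s hs
    apply interior_subset (hball _)
    rw [Metric.mem_ball, Real.dist_eq, abs_lt]
    constructor <;> linarith [hs.1, hs.2]
  have hlne := hSne l.1 l.2
  obtain ⟨⟨⟨a, b⟩, d⟩, hl⟩ : ∃ z : (Pt × Pt) × Unit, z.1 = l.1 := ⟨(l.1, ()), rfl⟩
  have hB' : ∀ s ∈ Icc s₀ (s₀ + ρ / 2), ∃ t, s ∈ Icc (-δ) δ ∧ t ∈ Icc 0 T ∧
      c + s • w + t • u ∈ frontier K ∧ cr (b - a) (c - a) + s * cr (b - a) w + t * cr (b - a) u = 0 := by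
    intro s hs
    obtain ⟨⟨s', t⟩, ⟨⟨e1, e2⟩, e3, e4⟩, rfl⟩ := hBin s hs
    refine ⟨t, e1, e2, e3, ?_⟩
    simp only [← hl] at e4
    rw [← e4, show c + s' • w + t • u - a = (c - a) + s' • w + t • u by abel, cr_add, cr_add,
      cr_smul, cr_smul]
  have hne : b - a ≠ 0 := by
    rw [← hl] at hlne; exact sub_ne_zero.2 hlne.symm
  obtain ⟨t₁, i1, j1, k1, m1⟩ := hB' s₀ ⟨le_rfl, by linarith⟩
  obtain ⟨t₂, i2, j2, k2, m2⟩ := hB' (s₀ + ρ / 2) ⟨by linarith, le_rfl⟩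
  have hpar : cr (b - a) u ≠ 0 := by
    intro h0
    apply hne
    apply cr_zero_of hu0 h0
    have : ρ / 2 * cr (b - a) w = 0 := by rw [h0] at m1 m2; linarith
    rcases mul_eq_zero.1 this with h | h
    · linarith
    · exact h
  refine ⟨c + s₀ • w + t₁ • u, c + (s₀ + ρ / 2) • w + t₂ • u, ?_, ?_, (hin _ i1).2.2 t₁ j1⟩
  · intro e
    have := congrArg (cr u) e
    simp only [cr_add, cr_smul, cr_self] at this
    have : ρ / 2 * cr u w = 0 := by linarith
    have := mul_pos (half_pos hρ) huw
    linarith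
  · intro p hp
    rw [segment_eq_image'] at hp
    obtain ⟨θ, hθ, rfl⟩ := hp
    obtain ⟨t, i, j, k, m⟩ := hB' (s₀ + θ * (ρ / 2)) ⟨by nlinarith [hθ.1], by nlinarith [hθ.2]⟩
    have ht : t = t₁ + θ * (t₂ - t₁) := by
      apply mul_right_cancel₀ hpar
      linear_combination m - (1 - θ) * m1 - θ * m2
    rw [ht] at k
    convert k using 1
    module


theorem cone_avoid {G a b y : Pt} (hy : cr (b - a) (y - a) ≠ 0)
    (hmeet : ∀ p ∈ segment ℝ G y, p ∈ segment ℝ a b → p = G) :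
    ∀ᶠ z in nhds y, ∀ t ∈ Ioc (0:ℝ) 1, G + t • (z - G) ∉ segment ℝ a b := by
  by_cases hG : G ∈ segment ℝ a b
  · have hc : Continuous (fun z : Pt => cr (b - a) (z - a)) := (cr_cont _).comp (by fun_prop)
    filter_upwards [(isOpen_ne.preimage hc).mem_nhds hy] with z hz t ht hmem
    have e1 := cr_seg hG
    have e2 := cr_seg hmem
    rw [show G + t • (z - G) - a = (1 - t) • (G - a) + t • (z - a) by module, cr_add, cr_smul,
      cr_smul, e1, mul_zero, zero_add] at e2
    rcases mul_eq_zero.1 e2 with h | h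
    · exact ht.1.ne' h
    · exact hz h
  · have hcl : IsClosed (segment ℝ a b) := by
      rw [← convexHull_pair]; exact (Set.toFinite _).isClosed_convexHull ℝ
    have : ∀ᶠ z in nhds y, ∀ t ∈ Icc (0:ℝ) 1, G + t • (z - G) ∉ segment ℝ a b := by
      apply isCompact_Icc.eventually_forall_of_forall_eventually
      intro t ht
      have hc : Continuous (fun z : Pt × ℝ => G + z.2 • (z.1 - G)) := by fun_prop
      refine (hcl.isOpen_compl.preimage hc).mem_nhds ?_
      intro hmem
      have hseg : G + t • (y - G) ∈ segment ℝ G y := by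
        rw [segment_eq_image']; exact ⟨t, ht, rfl⟩
      have := hmeet _ hseg hmem
      exact hG (this ▸ hmem)
    filter_upwards [this] with z hz t ht
    exact hz t (Ioc_subset_Icc_self ht)

theorem seg_closed (a b : Pt) : IsClosed (segment ℝ a b) := by
  rw [← convexHull_pair]; exact (Set.toFinite _).isClosed_convexHull ℝ

namespace SimplePolygon

variable (Γ : SimplePolygon)

theorem vertex_add_mul (i k : ℤ) : Γ.vertex (i + k * Γ.n) = Γ.vertex i := by
  induction k using Int.induction_on with
  | zero => simp
  | succ k ih =>
    rw [← ih, ← Γ.periodic (i + k * Γ.n)]; congr 1; ring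
  | pred k ih =>
    rw [← ih, ← Γ.periodic (i + (-k - 1) * Γ.n)]; congr 1; ring

theorem vertex_congr {i j : ℤ} (h : (Γ.n : ℤ) ∣ j - i) : Γ.vertex j = Γ.vertex i := by
  obtain ⟨k, hk⟩ := h
  rw [← Γ.vertex_add_mul i k]; congr 1; linarith

/-- edges -/
def edge (i : ℤ) : Set Pt := segment ℝ (Γ.vertex i) (Γ.vertex (i + 1))

theorem edge_congr {i j : ℤ} (h : (Γ.n : ℤ) ∣ j - i) : Γ.edge j = Γ.edge i := by
  unfold edge
  rw [Γ.vertex_congr h, Γ.vertex_congr (i := i + 1) (j := j + 1) (by simpa using h)]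

theorem npos : (0 : ℤ) < Γ.n := by have := Γ.three_le; omega

theorem exists_rep (i : ℤ) : ∃ j ∈ Finset.Ico (0:ℤ) Γ.n, (Γ.n : ℤ) ∣ i - j :=
  ⟨i % Γ.n, by
    rw [Finset.mem_Ico]
    exact ⟨Int.emod_nonneg _ Γ.npos.ne', Int.emod_lt_of_pos _ Γ.npos⟩, Int.dvd_self_sub_emod⟩

theorem mem_frontier_iff {p : Pt} :
    p ∈ frontier Γ.carrier ↔ ∃ i ∈ Finset.Ico (0:ℤ) Γ.n, p ∈ Γ.edge i := by
  rw [Γ.boundary_eq, mem_iUnion]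
  constructor
  · rintro ⟨i, hi⟩
    obtain ⟨j, hj, hd⟩ := Γ.exists_rep i
    exact ⟨j, hj, by rw [← Γ.edge_congr hd]; exact hi⟩
  · rintro ⟨i, -, hi⟩
    exact ⟨i, hi⟩

theorem vertex_ne (i : ℤ) : Γ.vertex i ≠ Γ.vertex (i + 1) := by
  obtain ⟨j, hj, hd⟩ := Γ.exists_rep i
  rw [Finset.mem_Ico] at hj
  rw [Γ.vertex_congr hd, Γ.vertex_congr (i := j + 1) (j := i + 1) (by simpa using hd)]
  have h3 := Γ.three_le
  intro e
  by_cases h : j + 1 < Γ.n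
  · have := Γ.vertex_inj j (j + 1) hj.1 hj.2 (by omega) h e
    omega
  · have hp := Γ.periodic 0
    rw [show j + 1 = 0 + Γ.n by omega, hp] at e
    have := Γ.vertex_inj j 0 hj.1 hj.2 le_rfl (by omega) e
    omega

theorem edge_inter {i j : ℤ} (hij : ¬ (Γ.n : ℤ) ∣ j - i) {p : Pt} (hi : p ∈ Γ.edge i)
    (hj : p ∈ Γ.edge j) : p = Γ.vertex i ∨ p = Γ.vertex (i + 1) := by
  by_cases h1 : (Γ.n : ℤ) ∣ j - (i + 1)
  · right
    have h := Γ.adj_edges i j h1 hij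
    have hp : p ∈ ({Γ.vertex j} : Set Pt) := h ▸ ⟨hi, hj⟩
    rw [mem_singleton_iff.1 hp, Γ.vertex_congr h1]
  · by_cases h2 : (Γ.n : ℤ) ∣ i - (j + 1)
    · left
      have h := Γ.adj_edges j i h2 (by rwa [dvd_sub_comm])
      have hp : p ∈ ({Γ.vertex i} : Set Pt) := h ▸ ⟨hj, hi⟩
      exact mem_singleton_iff.1 hp
    · exact absurd hj (disjoint_left.1 (Γ.nonadj_edges i j hij h1 h2) hi)

theorem no_cross {G y : Pt} (hsee : Γ.Sees G y) (i : ℤ)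
    (hline : cr (Γ.vertex (i + 1) - Γ.vertex i) (y - Γ.vertex i) ≠ 0)
    (hv : ∀ j, Γ.vertex j ≠ G → cr (Γ.vertex j - G) (y - G) ≠ 0)
    {p : Pt} (hp : p ∈ segment ℝ G y) (hpe : p ∈ Γ.edge i) : p = G := by
  by_contra hpG
  have hpe' : p ∈ segment ℝ (Γ.vertex i) (Γ.vertex (i + 1)) := hpe
  set a := Γ.vertex i with ha
  set b := Γ.vertex (i + 1) with hb
  have hp0 := hp
  rw [segment_eq_image'] at hp
  obtain ⟨s, hs, hps⟩ := hp
  simp only at hps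
  have hnv : ∀ j, p ≠ Γ.vertex j := by
    intro j e
    apply hv j (e ▸ hpG)
    rw [← e, ← hps, add_sub_cancel_left, cr_smul_left, cr_self, mul_zero]
  have hcrp := cr_seg hpe'
  -- isolate edge i
  have hcl : IsClosed (⋃ j ∈ (Finset.Ico (0:ℤ) Γ.n).filter (fun j => ¬ (Γ.n : ℤ) ∣ j - i),
      Γ.edge j) := by
    apply Set.Finite.isClosed_biUnion (Finset.finite_toSet _)
    intro j _
    exact seg_closed _ _
  have hpn : p ∉ (⋃ j ∈ (Finset.Ico (0:ℤ) Γ.n).filter (fun j => ¬ (Γ.n : ℤ) ∣ j - i),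
      Γ.edge j) := by
    intro h
    simp only [mem_iUnion] at h
    obtain ⟨j, hj, hpj⟩ := h
    rcases Γ.edge_inter (Finset.mem_filter.1 hj).2 hpe hpj with h | h
    · exact hnv _ h
    · exact hnv _ h
  obtain ⟨ε, hε, hball⟩ := Metric.isOpen_iff.1 hcl.isOpen_compl p hpn
  have hfr : ∀ z ∈ Metric.ball p ε, z ∈ frontier Γ.carrier → cr (b - a) (z - a) = 0 := by
    intro z hz hzf
    obtain ⟨j, hj, hzj⟩ := Γ.mem_frontier_iff.1 hzf
    by_cases hd : (Γ.n : ℤ) ∣ j - i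
    · rw [Γ.edge_congr hd] at hzj
      exact cr_seg hzj
    · exact absurd (mem_iUnion₂.2 ⟨j, Finset.mem_filter.2 ⟨hj, hd⟩, hzj⟩) (hball hz)
  set D := cr (b - a) (y - G) with hD
  have hyp : y - a = (p - a) + (1 - s) • (y - G) := by rw [← hps]; module
  have hs1D : (1 - s) * D ≠ 0 := by
    rw [hyp, cr_add, cr_smul, hcrp, zero_add] at hline
    exact hline
  have hD0 : D ≠ 0 := right_ne_zero_of_mul hs1D
  have hs1 : s < 1 := lt_of_le_of_ne hs.2 (fun e => left_ne_zero_of_mul hs1D (by rw [e, sub_self]))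
  have hs0 : 0 < s := lt_of_le_of_ne hs.1 (fun e => hpG (by rw [← hps, ← e]; simp))
  -- half discs
  have half : ∀ σ : ℝ, (σ = 1 ∨ σ = -1) → ∀ z ∈ Metric.ball p ε,
      0 < σ * (D * cr (b - a) (z - a)) → z ∈ Γ.carrier := by
    intro σ hσ
    have hconv : Convex ℝ (Metric.ball p ε ∩ {z | 0 < σ * (D * cr (b - a) (z - a))}) := by
      apply (convex_ball p ε).inter
      intro z₁ h₁ z₂ h₂ α β hα hβ hαβ
      simp only [mem_ofPred_eq] at h₁ h₂ ⊢
      have e : α • z₁ + β • z₂ - a = α • (z₁ - a) + β • (z₂ - a) := by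
        have : a = (α + β) • a := by rw [hαβ, one_smul]
        nth_rewrite 1 [this]; module
      rw [e, cr_add, cr_smul, cr_smul]
      have e2 : σ * (D * (α * cr (b - a) (z₁ - a) + β * cr (b - a) (z₂ - a))) =
        α * (σ * (D * cr (b - a) (z₁ - a))) + β * (σ * (D * cr (b - a) (z₂ - a))) := by ring
      rw [e2]
      rcases hα.eq_or_lt with h | h
      · have : β = 1 := by linarith
        rw [← h, this]; linarith
      · have := mul_pos h h₁
        have := mul_nonneg hβ h₂.le
        linarith
    -- point on the segment
    have hcont : Filter.Tendsto (fun η : ℝ => p + (σ * η) • (y - G)) (nhdsWithin 0 (Ioi 0))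
        (nhds p) := by
      have : Continuous (fun η : ℝ => p + (σ * η) • (y - G)) := by fun_prop
      have h := this.tendsto 0
      simp only [mul_zero, zero_smul, add_zero] at h
      exact h.mono_left nhdsWithin_le_nhds
    have hm : (0:ℝ) < min s (1 - s) := lt_min hs0 (by linarith)
    obtain ⟨η, ⟨hη1, hη2⟩, hη0⟩ := ((hcont.eventually (Metric.ball_mem_nhds p hε)).and
      ((nhdsWithin_le_nhds (Iio_mem_nhds hm)))).and self_mem_nhdsWithin |>.exists
    have hη0' : 0 < η := hη0
    have hη3 : η < s := lt_of_lt_of_le hη2 (min_le_left _ _)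
    have hη4 : η < 1 - s := lt_of_lt_of_le hη2 (min_le_right _ _)
    have hqC : p + (σ * η) • (y - G) ∈ Γ.carrier := by
      apply hsee
      rw [segment_eq_image']
      refine ⟨s + σ * η, ?_, ?_⟩
      · rcases hσ with rfl | rfl <;> constructor <;> linarith
      · simp only
        rw [← hps]; module
    have hsub := pre_sub (C := Γ.carrier) hconv.isPreconnected
      (fun z hz hzf => by
        have h2 := hz.2
        simp only [mem_ofPred_eq] at h2
        rw [hfr z hz.1 hzf] at h2
        simp at h2)
      (z := p + (σ * η) • (y - G))
      ⟨hη1, by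
        simp only [mem_ofPred_eq]
        rw [show p + (σ * η) • (y - G) - a = (p - a) + (σ * η) • (y - G) by abel, cr_add, cr_smul,
          hcrp, zero_add, ← hD]
        have e : σ * (D * (σ * η * D)) = σ ^ 2 * (η * D ^ 2) := by ring
        rw [e]
        have : σ ^ 2 = 1 := by rcases hσ with rfl | rfl <;> norm_num
        rw [this]
        positivity⟩ hqC
    intro z hz hz'
    exact hsub ⟨hz, hz'⟩
  have hoff : ∀ z ∈ Metric.ball p ε, cr (b - a) (z - a) ≠ 0 → z ∈ Γ.carrier := by
    intro z hz hne
    rcases lt_or_gt_of_ne (mul_ne_zero hD0 hne) with h | h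
    · exact half (-1) (Or.inr rfl) z hz (by linarith)
    · exact half 1 (Or.inl rfl) z hz (by linarith)
  have hin : Metric.ball p ε ⊆ Γ.carrier := by
    intro z hz
    by_cases h0 : cr (b - a) (z - a) = 0
    · have hcont : Filter.Tendsto (fun η : ℝ => z + η • (y - G)) (nhdsWithin 0 (Ioi 0))
          (nhds z) := by
        have : Continuous (fun η : ℝ => z + η • (y - G)) := by fun_prop
        have h := this.tendsto 0
        simp only [zero_smul, add_zero] at h
        exact h.mono_left nhdsWithin_le_nhds
      refine Γ.compact.isClosed.mem_of_tendsto hcont ?_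
      filter_upwards [hcont.eventually (Metric.isOpen_ball.mem_nhds hz), self_mem_nhdsWithin]
        with η h1 h2
      apply hoff _ h1
      rw [show z + η • (y - G) - a = (z - a) + η • (y - G) by abel, cr_add, cr_smul, h0, zero_add]
      exact mul_ne_zero (ne_of_gt h2) hD0
    · exact hoff z hz h0
  have hpf : p ∈ frontier Γ.carrier := by
    rw [Γ.boundary_eq]; exact mem_iUnion.2 ⟨i, hpe'⟩
  exact hpf.2 (mem_interior.2 ⟨_, hin, Metric.isOpen_ball, Metric.mem_ball_self hε⟩)

theorem sees_nhds {G y : Pt} (hG : G ∈ Γ.carrier) (hsee : Γ.Sees G y)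
    (hline : ∀ i, cr (Γ.vertex (i + 1) - Γ.vertex i) (y - Γ.vertex i) ≠ 0)
    (hv : ∀ j, Γ.vertex j ≠ G → cr (Γ.vertex j - G) (y - G) ≠ 0) :
    ∀ᶠ z in nhds y, Γ.Sees G z := by
  have hyC : y ∈ Γ.carrier := hsee (right_mem_segment ℝ G y)
  have hyi : y ∈ interior Γ.carrier := by
    by_contra h
    obtain ⟨i, -, hi⟩ := Γ.mem_frontier_iff.1 ⟨subset_closure hyC, h⟩
    exact hline i (cr_seg hi)
  have hall : ∀ᶠ z in nhds y, ∀ i ∈ Finset.Ico (0:ℤ) Γ.n, ∀ t ∈ Ioc (0:ℝ) 1,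
      G + t • (z - G) ∉ Γ.edge i := by
    rw [Filter.eventually_all_finset]
    intro i _
    exact cone_avoid (hline i) (fun p hp hpe => Γ.no_cross hsee i (hline i) hv hp hpe)
  filter_upwards [hall, isOpen_interior.mem_nhds hyi] with z hz hzi
  have hpre : IsPreconnected ((fun t : ℝ => G + t • (z - G)) '' Ioc 0 1) :=
    isPreconnected_Ioc.image _ (by fun_prop)
  have hsub := pre_sub (C := Γ.carrier) hpre (by
    rintro _ ⟨t, ht, rfl⟩ hf
    obtain ⟨i, hi, hmem⟩ := Γ.mem_frontier_iff.1 hf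
    exact hz i hi t ht hmem) (z := z) ⟨1, ⟨one_pos, le_rfl⟩, by simp⟩ (interior_subset hzi)
  intro p hp
  rw [segment_eq_image'] at hp
  obtain ⟨t, ht, rfl⟩ := hp
  rcases ht.1.eq_or_lt with h | h
  · simpa [← h] using hG
  · exact hsub ⟨t, ⟨h, ht.2⟩, rfl⟩

theorem isClosed_sees (G : Pt) : IsClosed {z | Γ.Sees G z} := by
  have : {z | Γ.Sees G z} = ⋂ t ∈ Icc (0:ℝ) 1, {z | G + t • (z - G) ∈ Γ.carrier} := by
    ext z
    simp only [mem_iInter, mem_ofPred_eq, Sees, segment_eq_image', image_subset_iff]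
    rfl
  rw [this]
  refine isClosed_biInter fun t _ => Γ.compact.isClosed.preimage (by fun_prop)

theorem isOpen_hidden {F : Set Pt} (hFfin : F.Finite)
    (hwalls : Γ.Covers F (frontier Γ.carrier)) : IsOpen (Γ.Hidden F) := by
  have : Γ.Hidden F = interior Γ.carrier ∩ (⋃ G ∈ F, {z | Γ.Sees G z})ᶜ := by
    ext z
    constructor
    · rintro ⟨h1, h2⟩
      refine ⟨?_, ?_⟩
      · by_contra h
        obtain ⟨G, hG, hs⟩ := hwalls z ⟨subset_closure h1, h⟩
        exact h2 G hG hs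
      · intro h
        obtain ⟨G, hG, hs⟩ := mem_iUnion₂.1 h
        exact h2 G hG hs
    · rintro ⟨h1, h2⟩
      exact ⟨interior_subset h1, fun G hG hs => h2 (mem_iUnion₂.2 ⟨G, hG, hs⟩)⟩
  rw [this]
  exact isOpen_interior.inter (hFfin.isClosed_biUnion fun G _ => Γ.isClosed_sees G).isOpen_compl

/-- the critical lines -/
def critLines (F : Set Pt) : Set (Pt × Pt) :=
  range (fun i : ℤ => (Γ.vertex i, Γ.vertex (i + 1))) ∪
    {l | l.1 ∈ F ∧ l.2 ∈ range Γ.vertex ∧ l.2 ≠ l.1}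

theorem frontier_comp {F : Set Pt} (hF : F ⊆ Γ.carrier) (hFfin : F.Finite)
    (hwalls : Γ.Covers F (frontier Γ.carrier)) (x : Pt) :
    ∀ y ∈ frontier (connectedComponentIn (Γ.Hidden F) x),
      ∃ l ∈ Γ.critLines F, cr (l.2 - l.1) (y - l.1) = 0 := by
  intro y hy
  have hO := Γ.isOpen_hidden hFfin hwalls
  set R := connectedComponentIn (Γ.Hidden F) x with hR
  have hRo : IsOpen R := hO.connectedComponentIn
  have hRH : R ⊆ Γ.Hidden F := connectedComponentIn_subset _ _
  have hyR : y ∉ R := by have := hy.2; rwa [hRo.interior_eq] at this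
  have hyc : y ∈ closure R := hy.1
  have hyH : y ∉ Γ.Hidden F := by
    intro h
    obtain ⟨z, hz1, hz2⟩ := mem_closure_iff.1 hyc _ hO.connectedComponentIn
      (mem_connectedComponentIn h)
    have e1 := connectedComponentIn_eq hz1
    have e2 := connectedComponentIn_eq hz2
    apply hyR
    rw [hR, e2, ← e1]
    exact mem_connectedComponentIn h
  have hyC : y ∈ Γ.carrier :=
    closure_minimal (fun z hz => (hRH hz).1) Γ.compact.isClosed hyc
  obtain ⟨G, hG, hsee⟩ : ∃ G ∈ F, Γ.Sees G y := by
    by_contra h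
    push Not at h
    exact hyH ⟨hyC, h⟩
  by_contra hcon
  push Not at hcon
  have hev := Γ.sees_nhds (hF hG) hsee
    (fun i => hcon (Γ.vertex i, Γ.vertex (i + 1)) (Or.inl ⟨i, rfl⟩))
    (fun j hj => hcon (G, Γ.vertex j) (Or.inr ⟨hG, ⟨j, rfl⟩, hj⟩))
  obtain ⟨z, hz1, hz2⟩ := mem_closure_iff_nhds.1 hyc _ hev
  exact (hRH hz2).2 G hG hz1

theorem critLines_countable {F : Set Pt} (hFfin : F.Finite) : (Γ.critLines F).Countable := by
  apply (countable_range _).union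
  refine (hFfin.countable.prod (countable_range Γ.vertex)).mono ?_
  rintro l ⟨h1, h2, -⟩
  exact ⟨h1, h2⟩

theorem critLines_ne {F : Set Pt} : ∀ l ∈ Γ.critLines F, l.1 ≠ l.2 := by
  rintro l (⟨i, rfl⟩ | ⟨-, -, h⟩)
  · exact Γ.vertex_ne i
  · exact h.symm

end SimplePolygon

/-- the closure of a connected component of the hidden region has at least
three boundary segments, hence at least three distinct support lines. -/
theorem three_support_lines (Γ : SimplePolygon) (F : Set Pt) (hF : F ⊆ Γ.carrier) (hFfin : F.Finite)
    (hwalls : Γ.Covers F (frontier Γ.carrier)) (hnotall : ¬ Γ.Covers F Γ.carrier)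
    (x : Pt) (hx : x ∈ Γ.Hidden F) :
    (∃ s₁ s₂ s₃ : Set Pt, s₁ ≠ s₂ ∧ s₁ ≠ s₃ ∧ s₂ ≠ s₃ ∧
      (∀ s ∈ ({s₁, s₂, s₃} : Set (Set Pt)), ∃ A B : Pt,
        IsBoundarySegment (closure (connectedComponentIn (Γ.Hidden F) x)) A B ∧
        s = segment ℝ A B)) ∧
    ∃ ℓ₁ ℓ₂ ℓ₃ : AffineSubspace ℝ Pt, ℓ₁ ≠ ℓ₂ ∧ ℓ₁ ≠ ℓ₃ ∧ ℓ₂ ≠ ℓ₃ ∧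
      IsSupportLine (connectedComponentIn (Γ.Hidden F) x) ℓ₁ ∧
      IsSupportLine (connectedComponentIn (Γ.Hidden F) x) ℓ₂ ∧
      IsSupportLine (connectedComponentIn (Γ.Hidden F) x) ℓ₃ := by
  have hO := Γ.isOpen_hidden hFfin hwalls
  have hfr := Γ.frontier_comp hF hFfin hwalls x
  set R := connectedComponentIn (Γ.Hidden F) x with hR
  have hRo : IsOpen R := hO.connectedComponentIn
  have hxR : x ∈ R := mem_connectedComponentIn hx
  have hRC : closure R ⊆ Γ.carrier :=
    closure_minimal (fun z hz => (connectedComponentIn_subset _ _ hz).1) Γ.compact.isClosed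
  have hK : IsCompact (closure R) := Γ.compact.of_isClosed_subset isClosed_closure hRC
  have hKi : (interior (closure R)).Nonempty :=
    ⟨x, interior_mono subset_closure (hRo.interior_eq.symm ▸ hxR)⟩
  have key := find_seg hK hKi (Γ.critLines_countable hFfin) Γ.critLines_ne
    (fun y hy => hfr y (frontier_closure_subset hy))
  obtain ⟨A₁, B₁, hne₁, hs₁, -⟩ :=
    key (Γ.vertex 0) (Γ.vertex (0 + 1)) (Γ.vertex 0) (Γ.vertex (0 + 1)) (Γ.vertex_ne 0)
      (Γ.vertex_ne 0)
  obtain ⟨A₂, B₂, hne₂, hs₂, h21, -⟩ := key A₁ B₁ A₁ B₁ hne₁ hne₁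
  obtain ⟨A₃, B₃, hne₃, hs₃, h31, h32⟩ := key A₁ B₁ A₂ B₂ hne₁ hne₂
  have l12 : affineSpan ℝ ({A₁, B₁} : Set Pt) ≠ affineSpan ℝ ({A₂, B₂} : Set Pt) := fun e =>
    h21 (cr_span (e ▸ left_mem_affineSpan_pair ℝ A₂ B₂))
  have l13 : affineSpan ℝ ({A₁, B₁} : Set Pt) ≠ affineSpan ℝ ({A₃, B₃} : Set Pt) := fun e =>
    h31 (cr_span (e ▸ left_mem_affineSpan_pair ℝ A₃ B₃))
  have l23 : affineSpan ℝ ({A₂, B₂} : Set Pt) ≠ affineSpan ℝ ({A₃, B₃} : Set Pt) := fun e =>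
    h32 (cr_span (e ▸ left_mem_affineSpan_pair ℝ A₃ B₃))
  obtain ⟨C₁, D₁, b₁, e₁⟩ := extend_seg hK hne₁ hs₁
  obtain ⟨C₂, D₂, b₂, e₂⟩ := extend_seg hK hne₂ hs₂
  obtain ⟨C₃, D₃, b₃, e₃⟩ := extend_seg hK hne₃ hs₃
  rw [← e₁, ← e₂] at l12
  rw [← e₁, ← e₃] at l13
  rw [← e₂, ← e₃] at l23
  refine ⟨⟨segment ℝ C₁ D₁, segment ℝ C₂ D₂, segment ℝ C₃ D₃, ?_, ?_, ?_, ?_⟩,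
    _, _, _, l12, l13, l23, ⟨C₁, D₁, b₁, rfl⟩, ⟨C₂, D₂, b₂, rfl⟩, ⟨C₃, D₃, b₃, rfl⟩⟩
  · intro e; apply l12; rw [← span_seg, ← span_seg, e]
  · intro e; apply l13; rw [← span_seg, ← span_seg, e]
  · intro e; apply l23; rw [← span_seg, ← span_seg, e]
  · rintro s (rfl | rfl | rfl)
    · exact ⟨C₁, D₁, b₁, rfl⟩
    · exact ⟨C₂, D₂, b₂, rfl⟩
    · exact ⟨C₃, D₃, b₃, rfl⟩
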